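/- arXiv:1102.1464 — 2 statements merged into one kernel-verified Lean document; each statement's English description precedes it below -/
import Mathlib

section
/- Let m ≥ 2. The sequence n ↦ Frac((1/n)·binomial(n, m)), for n ≥ 1, is periodic with period length m · ∏_{p prime, p ∣ m} p^⌊log_p (m−1)⌋. -/
/-- If `p ^ (a + ⌊log_p k⌋)` divides `M`, then `p ^ a` divides `C(M, j)` for `0 < j ≤ k`. -/
theorem Nat.Prime.pow_dvd_choose_of_pow_add_log_dvd {p a k M j : ℕ} (hp : p.Prime)
    (hM : p ^ (a + Nat.log p k) ∣ M) (hj : 0 < j) (hjk : j ≤ k) : p ^ a ∣ M.choose j := by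
  obtain ⟨e, u, hu, rfl⟩ := Nat.exists_eq_pow_mul_and_not_dvd hj.ne' p hp.ne_one
  have hu0 : 0 < u := Nat.pos_of_ne_zero (by rintro rfl; simp at hu)
  have he : e ≤ Nat.log p k :=
    Nat.le_log_of_pow_le hp.one_lt ((Nat.le_mul_of_pos_right _ hu0).trans hjk)
  have hdvd : M ∣ M.choose (p ^ e * u) * (p ^ e * u) := by
    rcases M with _ | M
    · simp [Nat.choose_eq_zero_of_lt hj]
    · obtain ⟨i, hi⟩ := Nat.exists_eq_succ_of_ne_zero hj.ne'
      rw [hi, Nat.succ_eq_add_one, ← Nat.add_one_mul_choose_eq]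
      exact dvd_mul_right _ _
  have h : p ^ e * p ^ a ∣ p ^ e * (u * M.choose (p ^ e * u)) := by
    rw [← pow_add, add_comm, ← mul_assoc, mul_comm (p ^ e * u)]
    exact (pow_dvd_pow p (Nat.add_le_add_left he a)).trans (hM.trans hdvd)
  exact (((Nat.Prime.coprime_iff_not_dvd hp).2 hu).pow_left a).dvd_of_dvd_mul_left
    (Nat.dvd_of_mul_dvd_mul_left (pow_pos hp.pos e) h)

/-- `m` divides `C(m * ∏_{p ∣ m} p ^ ⌊log_p k⌋, j)` for `0 < j ≤ k`. -/
theorem Nat.dvd_choose_mul_prod_primeFactors_pow_log {m k j : ℕ} (hm : m ≠ 0)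
    (hj : 0 < j) (hjk : j ≤ k) :
    m ∣ (m * ∏ p ∈ m.primeFactors, p ^ Nat.log p k).choose j := by
  rw [Nat.dvd_iff_prime_pow_dvd_dvd]
  intro p a hp ha
  rcases Nat.eq_zero_or_pos a with rfl | ha0
  · simp
  refine hp.pow_dvd_choose_of_pow_add_log_dvd ?_ hj hjk
  have hpm : p ∈ m.primeFactors :=
    Nat.mem_primeFactors.2 ⟨hp, (dvd_pow_self p ha0.ne').trans ha, hm⟩
  rw [pow_add]
  exact mul_dvd_mul ha (Finset.dvd_prod_of_mem (fun p => p ^ Nat.log p k) hpm)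

/-- If `m` divides `C(M, j)` for all `0 < j ≤ k`, then `C(x + M, k) ≡ C(x, k)` modulo `m`. -/
theorem Nat.add_choose_modEq {m M k : ℕ} (h : ∀ j, 0 < j → j ≤ k → m ∣ M.choose j) (x : ℕ) :
    (x + M).choose k ≡ x.choose k [MOD m] := by
  rw [add_comm, Nat.add_choose_eq, Finset.Nat.sum_antidiagonal_eq_sum_range_succ_mk,
    Finset.sum_range_succ']
  have hs : m ∣ ∑ i ∈ Finset.range k, M.choose (i + 1) * x.choose (k - (i + 1)) :=
    Finset.dvd_sum fun i hi =>
      (h (i + 1) i.succ_pos (Finset.mem_range.1 hi)).mul_right _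
  simpa using ((Nat.modEq_zero_iff_dvd.2 hs).add_right (x.choose k))

/-- `C(n, m) / n = C(n - 1, m - 1) / m`. -/
theorem Nat.cast_choose_succ_div_succ (n m : ℕ) :
    ((n + 1).choose (m + 1) : ℚ) / ((n + 1 : ℕ) : ℚ) = (n.choose m : ℚ) / ((m + 1 : ℕ) : ℚ) := by
  rw [div_eq_div_iff (by positivity) (by positivity)]
  exact_mod_cast (Nat.add_one_mul_choose_eq n m).symm.trans (mul_comm _ _)

/-- Numbers congruent modulo `m` have the same fractional part after division by `m`. -/
theorem Nat.ModEq.fract_div_eq {a b m : ℕ} (h : a ≡ b [MOD m]) (hm : m ≠ 0) :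
    Int.fract ((a : ℚ) / m) = Int.fract ((b : ℚ) / m) := by
  obtain ⟨c, hc⟩ := (Nat.modEq_iff_dvd.1 h.symm)
  refine Int.fract_eq_fract.2 ⟨c, ?_⟩
  have hm' : (m : ℚ) ≠ 0 := Nat.cast_ne_zero.2 hm
  have hc' : (a : ℚ) - b = m * c := by exact_mod_cast hc
  rw [← sub_div, hc', mul_div_cancel_left₀ _ hm']

/-- For `m ≥ 2`, the sequence `n ↦ Frac((1/n)·C(n,m))` (for `n ≥ 1`) is periodic with
period length `m * ∏_{p prime, p ∣ m} p ^ ⌊log_p (m-1)⌋`. -/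
theorem frac_choose_div_periodic (m : ℕ) (hm : 2 ≤ m) :
    ∀ n : ℕ, 1 ≤ n →
      Int.fract (((n + m * ∏ p ∈ m.primeFactors, p ^ Nat.log p (m - 1)).choose m : ℚ) /
          (n + m * ∏ p ∈ m.primeFactors, p ^ Nat.log p (m - 1))) =
        Int.fract ((n.choose m : ℚ) / n) := by
  intro n hn
  have hmod := Nat.add_choose_modEq (fun j hj hjk =>
    Nat.dvd_choose_mul_prod_primeFactors_pow_log (k := m - 1) (by omega : m ≠ 0) hj hjk) (n - 1)
  have hfract := hmod.fract_div_eq (by omega)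
  have hden : (n : ℚ) + m * ∏ p ∈ m.primeFactors, (p : ℚ) ^ Nat.log p (m - 1) =
      ((n + m * ∏ p ∈ m.primeFactors, p ^ Nat.log p (m - 1) : ℕ) : ℚ) := by
    push_cast
    rfl
  have key (N : ℕ) (hN : 1 ≤ N) :
      (N.choose m : ℚ) / (N : ℚ) = ((N - 1).choose (m - 1) : ℚ) / (m : ℚ) := by
    have := Nat.cast_choose_succ_div_succ (N - 1) (m - 1)
    rwa [Nat.sub_add_cancel hN, Nat.sub_add_cancel (by omega)] at this
  push_cast
  rw [hden, key _ (by omega), key n hn, Nat.sub_add_comm hn]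
  exact hfract
end

section
/- (Davis–Webb) For every n ≥ 1, writing a_{4,3}(n) for the number of integers m with 0 ≤ m ≤ n such that binomial(n, m) ≡ 3 (mod 4): if the binary representation of n contains no occurrence of the two-digit block 11 (i.e., no two consecutive 1 digits), then a_{4,3}(n) = 0; otherwise a_{4,3}(n) = 2^{|n|_1 − 1}. Here |n|_1 is the number of 1 digits in the binary representation of n. -/
theorem Nat.two_mul_dvd_choose_two_mul_odd_mul (n j : ℕ) :
    2 * n ∣ (2 * n).choose (2 * j + 1) * (2 * j + 1) := by
  rcases n with _ | n
  · simp
  · exact ⟨(2 * n + 1).choose (2 * j), (Nat.add_one_mul_choose_eq (2 * n + 1) (2 * j)).symm⟩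

theorem Nat.two_dvd_choose_two_mul_odd (n j : ℕ) : 2 ∣ (2 * n).choose (2 * j + 1) := by
  have h := (Dvd.intro n rfl).trans (Nat.two_mul_dvd_choose_two_mul_odd_mul n j)
  exact (Nat.Coprime.symm (by simp)).dvd_of_dvd_mul_right h

theorem Nat.four_dvd_choose_two_mul_odd {n : ℕ} (hn : Even n) (j : ℕ) :
    4 ∣ (2 * n).choose (2 * j + 1) := by
  have h4 : 4 ∣ 2 * n := by grind
  refine (Nat.Coprime.symm ?_).dvd_of_dvd_mul_right
    (h4.trans (Nat.two_mul_dvd_choose_two_mul_odd_mul n j))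
  exact Nat.Coprime.pow_right 2 (by simp : Nat.Coprime (2 * j + 1) 2)

theorem Nat.choose_two_mul_two_mul_mod_four (n j : ℕ) :
    (2 * n).choose (2 * j) % 4 = n.choose j % 4 := by
  induction n generalizing j with
  | zero => rcases j with _ | j <;> simp [Nat.choose, Nat.mul_add]
  | succ n ih =>
    rcases j with _ | j
    · simp
    · have h₁ : (2 * (n + 1)).choose (2 * (j + 1)) = (2 * n).choose (2 * j) +
          2 * (2 * n).choose (2 * j + 1) + (2 * n).choose (2 * (j + 1)) := by
        simp only [Nat.mul_add, Nat.mul_one, Nat.choose_succ_succ']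
        ring
      have h₂ := Nat.choose_succ_succ' n j
      have h₃ := Nat.two_dvd_choose_two_mul_odd n j
      have := ih j
      have := ih (j + 1)
      omega

theorem Nat.choose_two_mul_add_one_two_mul_mod_two (n j : ℕ) :
    (2 * n + 1).choose (2 * j) % 2 = n.choose j % 2 := by
  rcases j with _ | j
  · simp
  · have h₁ := Nat.choose_succ_succ' (2 * n) (2 * j + 1)
    have h₂ := Nat.two_dvd_choose_two_mul_odd n j
    have h₃ := Nat.choose_two_mul_two_mul_mod_four n (j + 1)
    rw [show 2 * (j + 1) = 2 * j + 1 + 1 by ring] at h₃ ⊢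
    omega

theorem Nat.choose_two_mul_add_one_odd_mod_two (n j : ℕ) :
    (2 * n + 1).choose (2 * j + 1) % 2 = n.choose j % 2 := by
  have h₁ := Nat.choose_succ_succ' (2 * n) (2 * j)
  have h₂ := Nat.two_dvd_choose_two_mul_odd n j
  have h₃ := Nat.choose_two_mul_two_mul_mod_four n j
  omega

theorem Nat.choose_two_mul_add_one_two_mul_mod_four {n : ℕ} (hn : Even n) (j : ℕ) :
    (2 * n + 1).choose (2 * j) % 4 = n.choose j % 4 := by
  rcases j with _ | j
  · simp
  · have h₁ := Nat.choose_succ_succ' (2 * n) (2 * j + 1)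
    have h₂ := Nat.four_dvd_choose_two_mul_odd hn j
    have h₃ := Nat.choose_two_mul_two_mul_mod_four n (j + 1)
    rw [show 2 * (j + 1) = 2 * j + 1 + 1 by ring] at h₃ ⊢
    omega

theorem Nat.choose_two_mul_add_one_odd_mod_four {n : ℕ} (hn : Even n) (j : ℕ) :
    (2 * n + 1).choose (2 * j + 1) % 4 = n.choose j % 4 := by
  have h₁ := Nat.choose_succ_succ' (2 * n) (2 * j)
  have h₂ := Nat.four_dvd_choose_two_mul_odd hn j
  have h₃ := Nat.choose_two_mul_two_mul_mod_four n j
  omega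

theorem Nat.four_dvd_choose_two_mul_add_one_add_choose {n : ℕ} (hn : Odd n) (j : ℕ) :
    4 ∣ (2 * n + 1).choose (2 * j) + (2 * n + 1).choose (2 * j + 1) := by
  rw [← Nat.choose_succ_succ']
  have h := Nat.add_one_mul_choose_eq (2 * n + 1) (2 * j)
  have h4 : 4 ∣ 2 * n + 1 + 1 := by grind
  refine (Nat.Coprime.symm ?_).dvd_of_dvd_mul_right (h ▸ h4.mul_right _)
  exact Nat.Coprime.pow_right 2 (by simp : Nat.Coprime (2 * j + 1) 2)

theorem Finset.sum_range_two_mul {M : Type*} [AddCommMonoid M] (f : ℕ → M) (n : ℕ) :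
    ∑ m ∈ Finset.range (2 * n), f m = ∑ j ∈ Finset.range n, (f (2 * j) + f (2 * j + 1)) := by
  induction n with
  | zero => simp
  | succ n ih =>
    rw [Nat.mul_succ, Finset.sum_range_succ, Finset.sum_range_succ, ih, Finset.sum_range_succ,
      add_assoc]

/-- The number of entries of row `n` of Pascal's triangle which satisfy `p`. -/
def chooseCount (p : ℕ → Prop) [DecidablePred p] (n : ℕ) : ℕ :=
  ((Finset.range (n + 1)).filter fun m => p (n.choose m)).card

section

variable (p : ℕ → Prop) [DecidablePred p]

theorem chooseCount_eq_sum (n : ℕ) :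
    chooseCount p n = ∑ m ∈ Finset.range (n + 1), if p (n.choose m) then 1 else 0 :=
  Finset.card_filter _ _

theorem chooseCount_two_mul_add_one (n : ℕ) :
    chooseCount p (2 * n + 1) = ∑ j ∈ Finset.range (n + 1),
      ((if p ((2 * n + 1).choose (2 * j)) then 1 else 0) +
        if p ((2 * n + 1).choose (2 * j + 1)) then 1 else 0) := by
  rw [chooseCount_eq_sum]
  exact Finset.sum_range_two_mul (fun m => if p ((2 * n + 1).choose m) then 1 else 0) (n + 1)

theorem chooseCount_two_mul (hp : ∀ a b, a % 4 = b % 4 → (p a ↔ p b))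
    (hp' : ∀ a, p a → a % 2 = 1) (n : ℕ) : chooseCount p (2 * n) = chooseCount p n := by
  have h (j : ℕ) : ¬ p ((2 * n).choose (2 * j + 1)) := fun hj => by
    have := hp' _ hj
    have := Nat.two_dvd_choose_two_mul_odd n j
    omega
  have h0 : ¬ p 0 := fun h0 => by simpa using hp' 0 h0
  have hs := Finset.sum_range_two_mul (fun m => if p ((2 * n).choose m) then 1 else 0) (n + 1)
  rw [Nat.mul_succ, Finset.sum_range_succ] at hs
  simpa [h, h0, chooseCount_eq_sum,
    fun j => hp _ _ (Nat.choose_two_mul_two_mul_mod_four n j)] using hs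

end

theorem chooseCount_odd_two_mul_add_one (n : ℕ) :
    chooseCount (· % 2 = 1) (2 * n + 1) = 2 * chooseCount (· % 2 = 1) n := by
  rw [chooseCount_two_mul_add_one, chooseCount_eq_sum, Finset.mul_sum]
  refine Finset.sum_congr rfl fun j _ => ?_
  rw [Nat.choose_two_mul_add_one_two_mul_mod_two, Nat.choose_two_mul_add_one_odd_mod_two, two_mul]

theorem chooseCount_three_two_mul_add_one_of_even {n : ℕ} (hn : Even n) :
    chooseCount (· % 4 = 3) (2 * n + 1) = 2 * chooseCount (· % 4 = 3) n := by
  rw [chooseCount_two_mul_add_one, chooseCount_eq_sum, Finset.mul_sum]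
  refine Finset.sum_congr rfl fun j _ => ?_
  rw [Nat.choose_two_mul_add_one_two_mul_mod_four hn,
    Nat.choose_two_mul_add_one_odd_mod_four hn, two_mul]

theorem chooseCount_three_two_mul_add_one_of_odd {n : ℕ} (hn : Odd n) :
    chooseCount (· % 4 = 3) (2 * n + 1) = chooseCount (· % 2 = 1) n := by
  rw [chooseCount_two_mul_add_one, chooseCount_eq_sum]
  refine Finset.sum_congr rfl fun j _ => ?_
  have h₁ := Nat.four_dvd_choose_two_mul_add_one_add_choose hn j
  have h₂ := Nat.choose_two_mul_add_one_two_mul_mod_two n j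
  split_ifs <;> omega

theorem Nat.count_one_digits_two_mul (n : ℕ) :
    (Nat.digits 2 (2 * n)).count 1 = (Nat.digits 2 n).count 1 := by
  rcases n.eq_zero_or_pos with rfl | hn
  · simp
  · have h := Nat.digits_add_two_add_one 0 (2 * n - 1)
    rw [show 2 * n - 1 + 1 = 2 * n by omega] at h
    simp [h]

theorem Nat.count_one_digits_two_mul_add_one (n : ℕ) :
    (Nat.digits 2 (2 * n + 1)).count 1 = (Nat.digits 2 n).count 1 + 1 := by
  simp [show (2 * n + 1) / 2 = n by omega]

theorem chooseCount_odd (n : ℕ) :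
    chooseCount (· % 2 = 1) n = 2 ^ (Nat.digits 2 n).count 1 := by
  induction n using Nat.evenOddRec with
  | h0 => rfl
  | h_even n ih =>
    rw [chooseCount_two_mul _ (by omega) (by omega), ih, Nat.count_one_digits_two_mul]
  | h_odd n ih =>
    rw [chooseCount_odd_two_mul_add_one, ih, Nat.count_one_digits_two_mul_add_one, pow_succ']

/-- The binary representation of `n` contains two consecutive digits `1`. -/
def Nat.HasAdjacentOnes (n : ℕ) : Prop :=
  ∃ i, n.testBit i ∧ n.testBit (i + 1)

theorem Nat.hasAdjacentOnes_two_mul (n : ℕ) : (2 * n).HasAdjacentOnes ↔ n.HasAdjacentOnes := by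
  unfold Nat.HasAdjacentOnes
  rw [Nat.or_exists_add_one.symm]
  simp [Nat.testBit_succ]

theorem Nat.hasAdjacentOnes_two_mul_add_one (n : ℕ) :
    (2 * n + 1).HasAdjacentOnes ↔ Odd n ∨ n.HasAdjacentOnes := by
  unfold Nat.HasAdjacentOnes
  rw [Nat.or_exists_add_one.symm]
  simp [Nat.testBit_succ, show (2 * n + 1) / 2 = n by omega, Nat.odd_iff]

open Classical in
theorem two_mul_chooseCount_three (n : ℕ) :
    2 * chooseCount (· % 4 = 3) n =
      if n.HasAdjacentOnes then 2 ^ (Nat.digits 2 n).count 1 else 0 := by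
  induction n using Nat.evenOddRec with
  | h0 => simp [chooseCount_eq_sum, Nat.HasAdjacentOnes]
  | h_even n ih =>
    rw [chooseCount_two_mul _ (by omega) (by omega), ih, Nat.count_one_digits_two_mul]
    simp only [Nat.hasAdjacentOnes_two_mul]
  | h_odd n ih =>
    simp only [Nat.hasAdjacentOnes_two_mul_add_one, Nat.count_one_digits_two_mul_add_one, pow_succ']
    rcases n.even_or_odd with hn | hn
    · rw [chooseCount_three_two_mul_add_one_of_even hn, ih]
      simp [Nat.not_odd_iff_even.mpr hn]
    · rw [chooseCount_three_two_mul_add_one_of_odd hn, chooseCount_odd]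
      simp [hn]

open Classical in
/-- (Davis–Webb) For `n ≥ 1`, the number of `0 ≤ m ≤ n` with `C(n,m) ≡ 3 (mod 4)` is
`0` if the binary representation of `n` has no two consecutive `1` digits, and
`2^{|n|₁ - 1}` otherwise, where `|n|₁` is the number of binary `1` digits of `n`. -/
theorem davis_webb_three (n : ℕ) (hn : 1 ≤ n) :
    ((Finset.range (n + 1)).filter fun m => n.choose m % 4 = 3).card =
      if ∀ i : ℕ, ¬ (n.testBit i ∧ n.testBit (i + 1)) then
        0
      else
        2 ^ ((Nat.digits 2 n).count 1 - 1) := by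
  have h := two_mul_chooseCount_three n
  have hc : ((Finset.range (n + 1)).filter fun m => n.choose m % 4 = 3).card =
      chooseCount (· % 4 = 3) n := by
    unfold chooseCount
    congr!
  have hP : (∀ i : ℕ, ¬ (n.testBit i ∧ n.testBit (i + 1))) ↔ ¬ n.HasAdjacentOnes :=
    not_exists.symm
  rw [hc]
  simp only [hP]
  by_cases hA : n.HasAdjacentOnes
  · simp only [hA, if_true, not_true_eq_false, if_false] at h ⊢
    rcases hk : (Nat.digits 2 n).count 1 with _ | k
    · rw [hk] at h
      omega
    · rw [hk, pow_succ'] at h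
      simpa using h
  · simpa [hA] using h
end
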